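/- If equality holds in the inequality Per_K(Ω ∼ λK) ≥ (1 − λ/r)^{n−1} Per_K(Ω) for some λ₀ ∈ (0, r), where r = r(Ω,K), then equality holds for all λ ∈ [0, r], i.e., the concave function λ ↦ Per_K(Ω ∼ λK)^{1/(n−1)} is affine on [0, r]. -/

import Mathlib

open Pointwise MeasureTheory Set

noncomputable section

/-- The inner parallel body `Ω ∼ λK = {x : x + λK ⊆ Ω}`. -/
def innerPar {n : ℕ} (Ω K : Set (EuclideanSpace ℝ (Fin n))) (l : ℝ) :
    Set (EuclideanSpace ℝ (Fin n)) :=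
  {x | ∀ y ∈ K, x + l • y ∈ Ω}

/-- The inradius of `Ω` relative to `K`. -/
def inrad {n : ℕ} (Ω K : Set (EuclideanSpace ℝ (Fin n))) : ℝ :=
  sSup {l : ℝ | 0 ≤ l ∧ ∃ x, ∀ y ∈ K, x + l • y ∈ Ω}

/-- The anisotropic perimeter of `C` relative to `K`, realized as the anisotropic
Minkowski content `d/dt V_n(C + tK) |_{t=0⁺}`. -/
def aniPer {n : ℕ} (C K : Set (EuclideanSpace ℝ (Fin n))) : ℝ :=
  derivWithin (fun t : ℝ => (volume (C + t • K)).toReal) (Set.Ici (0:ℝ)) 0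

/-- The mixed volume `V(C,…,C,K,…,K)` with `i` copies of `K`, extracted as the
`i`-th Taylor coefficient (over `binom n i`) of `t ↦ V_n(C + tK)` at `t = 0⁺`. -/
def mixedVol {n : ℕ} (i : ℕ) (C K : Set (EuclideanSpace ℝ (Fin n))) : ℝ :=
  iteratedDerivWithin i (fun t : ℝ => (volume (C + t • K)).toReal) (Set.Ici (0:ℝ)) 0
    / (n.choose i * i.factorial)

/-! ### The Prékopa–Leindler and Brunn–Minkowski inequalities -/

open scoped ENNReal Topology

open Filter

/-- Weighted arithmetic-geometric mean inequality in `ℝ≥0∞`. -/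
theorem ennreal_geom_mean_le_arith_mean {a b : ℝ} (ha : 0 < a) (hb : 0 < b) (hab : a + b = 1)
    (x y : ℝ≥0∞) : x ^ a * y ^ b ≤ ENNReal.ofReal a * x + ENNReal.ofReal b * y := by
  rcases eq_or_ne x ∞ with rfl | hx
  · rw [ENNReal.mul_top (by simpa using ha)]
    simp
  rcases eq_or_ne y ∞ with rfl | hy
  · rw [ENNReal.mul_top (by simpa using hb)]
    simp
  lift x to NNReal using hx
  lift y to NNReal using hy
  lift a to NNReal using ha.le
  lift b to NNReal using hb.le
  rw [← ENNReal.coe_rpow_of_nonneg x a.coe_nonneg, ← ENNReal.coe_rpow_of_nonneg y b.coe_nonneg,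
    ENNReal.ofReal_coe_nnreal, ENNReal.ofReal_coe_nnreal]
  exact_mod_cast NNReal.geom_mean_le_arith_mean2_weighted a b x y (by exact_mod_cast hab)

theorem IsCompact.volume_add_volume_le_real {A B C : Set ℝ} (hA : IsCompact A) (hB : IsCompact B)
    (hA0 : A.Nonempty) (hB0 : B.Nonempty) (h : ∀ x ∈ A, ∀ y ∈ B, x + y ∈ C) :
    volume A + volume B ≤ volume C := by
  obtain ⟨p, hp, hpm⟩ := hA.exists_isGreatest hA0
  obtain ⟨q, hq, hqm⟩ := hB.exists_isLeast hB0
  have e1 : volume ((fun x => q + x) '' A) = volume A := by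
    rw [Set.image_add_left, measure_preimage_add]
  have e2 : volume ((fun x => p + x) '' B) = volume B := by
    rw [Set.image_add_left, measure_preimage_add]
  rw [← e1, ← e2]
  have hd : AEDisjoint volume ((fun x => q + x) '' A) ((fun x => p + x) '' B) := by
    refine measure_mono_null (t := {p + q}) ?_ (by simp)
    rintro _ ⟨⟨x, hx, rfl⟩, ⟨y, hy, hxy⟩⟩
    have h1 := hpm hx
    have h2 := hqm hy
    simp only at hxy
    simp only [mem_singleton_iff]
    linarith
  rw [← measure_union₀ ((hB.image (by fun_prop)).measurableSet.nullMeasurableSet) hd]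
  apply measure_mono
  rintro _ (⟨x, hx, rfl⟩ | ⟨y, hy, rfl⟩)
  · simpa only [add_comm q x] using h x hx q hq
  · exact h p hp y hy

/-- The one-dimensional Brunn–Minkowski inequality for measurable sets. -/
theorem volume_add_volume_le_real {A B C : Set ℝ} (hA : MeasurableSet A) (hB : MeasurableSet B)
    (hA0 : A.Nonempty) (hB0 : B.Nonempty) (h : ∀ x ∈ A, ∀ y ∈ B, x + y ∈ C) :
    volume A + volume B ≤ volume C := by
  obtain ⟨p, hp⟩ := hA0
  obtain ⟨q, hq⟩ := hB0
  rw [hA.measure_eq_iSup_isCompact, hB.measure_eq_iSup_isCompact]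
  simp only [iSup_and']
  refine ENNReal.biSup_add_biSup_le' ⟨∅, by simp⟩ ⟨∅, by simp⟩ ?_
  rintro S ⟨hS, hSc⟩ T ⟨hT, hTc⟩
  calc volume S + volume T ≤ volume (insert p S) + volume (insert q T) := by gcongr <;> simp
    _ ≤ volume C := by
      refine (hSc.insert p).volume_add_volume_le_real (hTc.insert q) (by simp) (by simp) ?_
      intro x hx y hy
      exact h x (insert_subset hp hS hx) y (insert_subset hq hT hy)

theorem lintegral_min_one_eq {f : ℝ → ℝ≥0∞} (hf : Measurable f) :
    ∫⁻ x, min (f x) 1 = ∫⁻ t in Ioo (0 : ℝ) 1, volume {x | ENNReal.ofReal t < f x} := by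
  have hfin : ∀ x, min (f x) 1 ≠ ∞ := fun x => ne_top_of_le_ne_top ENNReal.one_ne_top (min_le_right _ _)
  have h1 : ∀ x, min (f x) 1 = ENNReal.ofReal (min (f x) 1).toReal := fun x =>
    (ENNReal.ofReal_toReal (hfin x)).symm
  have hlt : ∀ t x, 0 ≤ t → (t < (min (f x) 1).toReal ↔ ENNReal.ofReal t < min (f x) 1) :=
    fun t x ht => (ENNReal.ofReal_lt_iff_lt_toReal ht (hfin x)).symm
  rw [lintegral_congr h1, lintegral_eq_lintegral_meas_lt _ (ae_of_all _ fun x => ENNReal.toReal_nonneg)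
    ((hf.min measurable_const).ennreal_toReal.aemeasurable)]
  rw [← Ioo_union_Ici_eq_Ioi (zero_lt_one (α := ℝ)), lintegral_union measurableSet_Ici
    (by rw [Set.disjoint_left]; intro x hx hx'; exact absurd hx.2 (not_lt.2 hx'))]
  have h2 : ∫⁻ t in Ici (1 : ℝ), volume {a | t < (min (f a) 1).toReal} = 0 := by
    rw [setLIntegral_congr_fun (g := fun _ => 0) measurableSet_Ici]
    · simp
    · intro t ht
      have : {a | t < (min (f a) 1).toReal} = ∅ := by
        ext x
        simp only [mem_ofPred_eq, mem_empty_iff_false, iff_false, not_lt]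
        refine le_trans ?_ (mem_Ici.1 ht)
        exact ENNReal.toReal_le_of_le_ofReal zero_le_one (by simp)
      simp [this]
  rw [h2, add_zero]
  refine setLIntegral_congr_fun measurableSet_Ioo fun t ht => ?_
  congr 1
  ext x
  simp only [mem_ofPred_eq]
  rw [hlt t x ht.1.le, lt_min_iff, and_iff_left]
  simpa using ht.2

/-- One-dimensional Prékopa–Leindler inequality for functions with supremum one. -/
theorem prekopa_leindler_real_of_iSup_eq_one {a b : ℝ} (ha : 0 < a) (hb : 0 < b) (hab : a + b = 1)
    {f g h : ℝ → ℝ≥0∞} (hf : Measurable f) (hg : Measurable g) (hh : Measurable h)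
    (hf1 : ⨆ x, f x = 1) (hg1 : ⨆ x, g x = 1)
    (H : ∀ x y, f x ^ a * g y ^ b ≤ h (a * x + b * y)) :
    (∫⁻ x, f x) ^ a * (∫⁻ x, g x) ^ b ≤ ∫⁻ x, h x := by
  refine (ennreal_geom_mean_le_arith_mean ha hb hab _ _).trans ?_
  have e1 : ∫⁻ x, f x = ∫⁻ x, min (f x) 1 :=
    lintegral_congr fun x => (min_eq_left (hf1 ▸ le_iSup f x)).symm
  have e2 : ∫⁻ x, g x = ∫⁻ x, min (g x) 1 :=
    lintegral_congr fun x => (min_eq_left (hg1 ▸ le_iSup g x)).symm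
  refine le_trans ?_ (lintegral_mono fun x => min_le_left (h x) 1)
  rw [e1, e2, lintegral_min_one_eq hf, lintegral_min_one_eq hg, lintegral_min_one_eq hh,
    ← lintegral_const_mul' _ _ ENNReal.ofReal_ne_top, ← lintegral_const_mul' _ _ ENNReal.ofReal_ne_top]
  have hanti : Antitone fun t : ℝ => ENNReal.ofReal b * volume {x | ENNReal.ofReal t < g x} := by
    intro s t hst
    dsimp only
    gcongr
  rw [← lintegral_add_right _ hanti.measurable]
  refine setLIntegral_mono' measurableSet_Ioo fun t ht => ?_
  have hne : ∀ u : ℝ → ℝ≥0∞, ⨆ x, u x = 1 → {x | ENNReal.ofReal t < u x}.Nonempty := by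
    intro u hu
    have : ENNReal.ofReal t < ⨆ x, u x := by rw [hu]; simpa using ht.2
    exact lt_iSup_iff.1 this
  have hs : ∀ (c : ℝ) (_ : 0 < c) (S : Set ℝ), ENNReal.ofReal c * volume S = volume (c • S) := by
    intro c hc S
    rw [Measure.addHaar_smul_of_nonneg _ hc.le]
    simp
  rw [hs a ha, hs b hb]
  refine volume_add_volume_le_real ((measurableSet_lt measurable_const hf).const_smul_of_ne_zero ha.ne')
    ((measurableSet_lt measurable_const hg).const_smul_of_ne_zero hb.ne')
    ((hne f hf1).smul_set) ((hne g hg1).smul_set) ?_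
  rintro _ ⟨x, hx, rfl⟩ _ ⟨y, hy, rfl⟩
  refine lt_of_lt_of_le ?_ (H x y)
  have ht0 : ENNReal.ofReal t ≠ 0 := by simpa using ht.1
  calc ENNReal.ofReal t = ENNReal.ofReal t ^ a * ENNReal.ofReal t ^ b := by
        rw [← ENNReal.rpow_add _ _ ht0 ENNReal.ofReal_ne_top, hab, ENNReal.rpow_one]
    _ < f x ^ a * g y ^ b :=
        ENNReal.mul_lt_mul (ENNReal.rpow_lt_rpow hx ha) (ENNReal.rpow_lt_rpow hy hb)

theorem prekopa_leindler_real_of_bounded {a b : ℝ} (ha : 0 < a) (hb : 0 < b) (hab : a + b = 1)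
    {f g h : ℝ → ℝ≥0∞} (hf : Measurable f) (hg : Measurable g) (hh : Measurable h)
    (hf1 : ⨆ x, f x ≠ ∞) (hg1 : ⨆ x, g x ≠ ∞)
    (H : ∀ x y, f x ^ a * g y ^ b ≤ h (a * x + b * y)) :
    (∫⁻ x, f x) ^ a * (∫⁻ x, g x) ^ b ≤ ∫⁻ x, h x := by
  set M := ⨆ x, f x with hM
  set N := ⨆ x, g x with hN
  rcases eq_or_ne M 0 with hM0 | hM0
  · have : ∀ x, f x = 0 := by simpa [hM, ENNReal.iSup_eq_zero] using hM0
    simp [this, ENNReal.zero_rpow_of_pos ha]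
  rcases eq_or_ne N 0 with hN0 | hN0
  · have : ∀ x, g x = 0 := by simpa [hN, ENNReal.iSup_eq_zero] using hN0
    simp [this, ENNReal.zero_rpow_of_pos hb]
  have key := prekopa_leindler_real_of_iSup_eq_one ha hb hab (f := fun x => M⁻¹ * f x)
    (g := fun x => N⁻¹ * g x) (h := fun x => (M⁻¹ ^ a * N⁻¹ ^ b) * h x)
    (hf.const_mul _) (hg.const_mul _) (hh.const_mul _)
    (by rw [← ENNReal.mul_iSup, ← hM, ENNReal.inv_mul_cancel hM0 hf1])
    (by rw [← ENNReal.mul_iSup, ← hN, ENNReal.inv_mul_cancel hN0 hg1]) (by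
      intro x y
      rw [ENNReal.mul_rpow_of_nonneg _ _ ha.le, ENNReal.mul_rpow_of_nonneg _ _ hb.le,
        mul_mul_mul_comm]
      gcongr
      exact H x y)
  rw [lintegral_const_mul _ hf, lintegral_const_mul _ hg, lintegral_const_mul _ hh,
    ENNReal.mul_rpow_of_nonneg _ _ ha.le, ENNReal.mul_rpow_of_nonneg _ _ hb.le,
    mul_mul_mul_comm] at key
  refine (ENNReal.mul_le_mul_iff_right ?_ ?_).1 key
  · refine mul_ne_zero ?_ ?_
    · exact (ENNReal.rpow_pos (ENNReal.inv_pos.2 hf1) (ENNReal.inv_ne_top.2 hM0)).ne'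
    · exact (ENNReal.rpow_pos (ENNReal.inv_pos.2 hg1) (ENNReal.inv_ne_top.2 hN0)).ne'
  · exact ENNReal.mul_ne_top (ENNReal.rpow_ne_top_of_nonneg ha.le (ENNReal.inv_ne_top.2 hM0))
      (ENNReal.rpow_ne_top_of_nonneg hb.le (ENNReal.inv_ne_top.2 hN0))

/-- Truncations of a function at integer heights have integrals converging to its integral. -/
theorem tendsto_lintegral_min_natCast {α : Type*} [MeasurableSpace α] {μ : Measure α}
    {f : α → ℝ≥0∞} (hf : Measurable f) :
    Tendsto (fun k : ℕ => ∫⁻ x, min (f x) k ∂μ) atTop (𝓝 (∫⁻ x, f x ∂μ)) := by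
  refine lintegral_tendsto_of_tendsto_of_monotone (fun k => (hf.min measurable_const).aemeasurable)
    (ae_of_all _ fun x i j hij => ?_) (ae_of_all _ fun x => ?_)
  · dsimp only
    gcongr
  · have := (tendsto_const_nhds (x := f x)).min ENNReal.tendsto_nat_nhds_top
    simpa using this

/-- The one-dimensional Prékopa–Leindler inequality. -/
theorem prekopa_leindler_real {a b : ℝ} (ha : 0 < a) (hb : 0 < b) (hab : a + b = 1)
    {f g h : ℝ → ℝ≥0∞} (hf : Measurable f) (hg : Measurable g) (hh : Measurable h)
    (H : ∀ x y, f x ^ a * g y ^ b ≤ h (a * x + b * y)) :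
    (∫⁻ x, f x) ^ a * (∫⁻ x, g x) ^ b ≤ ∫⁻ x, h x := by
  rcases eq_or_ne (∫⁻ x, f x) 0 with hf0 | hf0
  · simp [hf0, ENNReal.zero_rpow_of_pos ha]
  rcases eq_or_ne (∫⁻ x, g x) 0 with hg0 | hg0
  · simp [hg0, ENNReal.zero_rpow_of_pos hb]
  have h1 : Tendsto (fun k : ℕ => (∫⁻ x, min (f x) k) ^ a * (∫⁻ x, min (g x) k) ^ b) atTop
      (𝓝 ((∫⁻ x, f x) ^ a * (∫⁻ x, g x) ^ b)) := by
    refine ENNReal.Tendsto.mul ((tendsto_lintegral_min_natCast hf).ennrpow_const a) (Or.inl ?_)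
      ((tendsto_lintegral_min_natCast hg).ennrpow_const b) (Or.inl ?_)
    · simp [ENNReal.rpow_eq_zero_iff, hf0, ha.not_gt]
    · simp [ENNReal.rpow_eq_zero_iff, hg0, hb.not_gt]
  refine le_of_tendsto' h1 fun k => ?_
  refine prekopa_leindler_real_of_bounded ha hb hab (hf.min measurable_const)
    (hg.min measurable_const) hh ?_ ?_ fun x y => ?_
  · exact ne_top_of_le_ne_top (ENNReal.natCast_ne_top k) (iSup_le fun x => min_le_right _ _)
  · exact ne_top_of_le_ne_top (ENNReal.natCast_ne_top k) (iSup_le fun x => min_le_right _ _)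
  · refine le_trans ?_ (H x y)
    gcongr <;> exact min_le_left _ _

/-- The Prékopa–Leindler inequality on `ℝⁿ`. -/
theorem prekopa_leindler_pi {a b : ℝ} (ha : 0 < a) (hb : 0 < b) (hab : a + b = 1) (n : ℕ) :
    ∀ {f g h : (Fin n → ℝ) → ℝ≥0∞}, Measurable f → Measurable g → Measurable h →
      (∀ x y, f x ^ a * g y ^ b ≤ h (a • x + b • y)) →
      (∫⁻ x, f x) ^ a * (∫⁻ x, g x) ^ b ≤ ∫⁻ x, h x := by
  induction n with
  | zero =>
    intro f g h _ _ _ H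
    have hv : volume (univ : Set (Fin 0 → ℝ)) = 1 := by simp [volume_pi]
    simp only [lintegral_unique, hv, mul_one]
    convert H default default
  | succ n ih =>
    intro f g h hf hg hh H
    let e := (MeasurableEquiv.piFinSuccAbove (fun _ : Fin (n + 1) => ℝ) 0).symm
    have he : MeasurePreserving e (volume.prod volume) volume :=
      (volume_preserving_piFinSuccAbove (fun _ : Fin (n + 1) => ℝ) 0).symm
    have hadd : ∀ (s t : ℝ) (x y : Fin n → ℝ),
        a • e (s, x) + b • e (t, y) = e (a * s + b * t, a • x + b • y) := by
      intro s t x y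
      ext i
      refine Fin.cases ?_ (fun j => ?_) i <;>
        simp [e, MeasurableEquiv.piFinSuccAbove_symm_apply]
    have hint : ∀ u : (Fin (n + 1) → ℝ) → ℝ≥0∞, Measurable u →
        ∫⁻ x, u x = ∫⁻ t : ℝ, ∫⁻ x : Fin n → ℝ, u (e (t, x)) := by
      intro u hu
      rw [← he.lintegral_comp hu]
      exact lintegral_prod _ (hu.comp e.measurable).aemeasurable
    have hmeas : ∀ u : (Fin (n + 1) → ℝ) → ℝ≥0∞, Measurable u →
        Measurable fun t : ℝ => ∫⁻ x : Fin n → ℝ, u (e (t, x)) := fun u hu =>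
      (hu.comp e.measurable).lintegral_prod_right'
    rw [hint f hf, hint g hg, hint h hh]
    refine prekopa_leindler_real ha hb hab (hmeas f hf) (hmeas g hg) (hmeas h hh) fun s t => ?_
    refine ih (by fun_prop) (by fun_prop) (by fun_prop) fun x y => ?_
    rw [← hadd]
    exact H _ _

/-- The multiplicative Brunn–Minkowski inequality. -/
theorem volume_rpow_mul_volume_rpow_le {n : ℕ} {a b : ℝ} (ha : 0 < a) (hb : 0 < b)
    (hab : a + b = 1) {A B C : Set (EuclideanSpace ℝ (Fin n))} (hA : MeasurableSet A)
    (hB : MeasurableSet B) (hC : MeasurableSet C) (h : ∀ x ∈ A, ∀ y ∈ B, a • x + b • y ∈ C) :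
    volume A ^ a * volume B ^ b ≤ volume C := by
  let e := MeasurableEquiv.toLp 2 (Fin n → ℝ)
  have hind : ∀ S : Set (EuclideanSpace ℝ (Fin n)), MeasurableSet S →
      volume S = ∫⁻ x : Fin n → ℝ, (e ⁻¹' S).indicator 1 x := by
    intro S hS
    rw [lintegral_indicator_one (e.measurable hS)]
    exact ((PiLp.volume_preserving_toLp (Fin n)).measure_preimage hS.nullMeasurableSet).symm
  rw [hind A hA, hind B hB, hind C hC]
  refine prekopa_leindler_pi ha hb hab n (measurable_one.indicator (e.measurable hA))
    (measurable_one.indicator (e.measurable hB)) (measurable_one.indicator (e.measurable hC))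
    fun x y => ?_
  by_cases hx : x ∈ e ⁻¹' A
  · by_cases hy : y ∈ e ⁻¹' B
    · have : a • x + b • y ∈ e ⁻¹' C := h _ hx _ hy
      simp [hx, hy, this]
    · simp [hy, ENNReal.zero_rpow_of_pos hb]
  · simp [hx, ENNReal.zero_rpow_of_pos ha]

/-- The Brunn–Minkowski inequality for compact sets. -/
theorem IsCompact.brunn_minkowski {n : ℕ} (hn : n ≠ 0) {A B C : Set (EuclideanSpace ℝ (Fin n))}
    (hA : IsCompact A) (hB : IsCompact B) (hC : IsCompact C) (hA0 : A.Nonempty) (hB0 : B.Nonempty)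
    (h : ∀ x ∈ A, ∀ y ∈ B, x + y ∈ C) :
    (volume A).toReal ^ (n : ℝ)⁻¹ + (volume B).toReal ^ (n : ℝ)⁻¹
      ≤ (volume C).toReal ^ (n : ℝ)⁻¹ := by
  have hninv : 0 < (n : ℝ)⁻¹ := by positivity
  set α := (volume A).toReal ^ (n : ℝ)⁻¹ with hα
  set β := (volume B).toReal ^ (n : ℝ)⁻¹ with hβ
  have hα0 : 0 ≤ α := by positivity
  have hβ0 : 0 ≤ β := by positivity
  rcases hα0.eq_or_lt with hα1 | hα1
  · obtain ⟨p, hp⟩ := hA0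
    rw [← hα1, zero_add]
    refine Real.rpow_le_rpow ENNReal.toReal_nonneg
      (ENNReal.toReal_mono hC.measure_lt_top.ne ?_) hninv.le
    rw [← measure_preimage_add volume (-p) B]
    refine measure_mono fun x hx => ?_
    simpa using h p hp _ hx
  rcases hβ0.eq_or_lt with hβ1 | hβ1
  · obtain ⟨q, hq⟩ := hB0
    rw [← hβ1, add_zero]
    refine Real.rpow_le_rpow ENNReal.toReal_nonneg
      (ENNReal.toReal_mono hC.measure_lt_top.ne ?_) hninv.le
    rw [← measure_preimage_add_right volume (-q) A]
    refine measure_mono fun x hx => ?_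
    simpa using h _ hx q hq
  have hvol : ∀ S : Set (EuclideanSpace ℝ (Fin n)), IsCompact S →
      volume S = ENNReal.ofReal (((volume S).toReal ^ (n : ℝ)⁻¹) ^ n) := by
    intro S hS
    rw [Real.rpow_inv_natCast_pow ENNReal.toReal_nonneg hn,
      ENNReal.ofReal_toReal hS.measure_lt_top.ne]
  have hone : ∀ (S : Set (EuclideanSpace ℝ (Fin n))) (c : ℝ), 0 < c → IsCompact S →
      c = (volume S).toReal ^ (n : ℝ)⁻¹ → volume (c⁻¹ • S) = 1 := by
    intro S c hc hS hcS
    rw [Measure.addHaar_smul_of_nonneg _ (inv_nonneg.2 hc.le), hvol S hS, ← hcS,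
      ← ENNReal.ofReal_mul (by positivity), finrank_euclideanSpace_fin, ← mul_pow,
      inv_mul_cancel₀ hc.ne']
    simp
  have hs : 0 < α + β := by positivity
  have key := volume_rpow_mul_volume_rpow_le (a := α / (α + β)) (b := β / (α + β))
    (A := α⁻¹ • A) (B := β⁻¹ • B) (C := (α + β)⁻¹ • C) (by positivity) (by positivity)
    (by field_simp) (hA.smul _).measurableSet (hB.smul _).measurableSet (hC.smul _).measurableSet
    (by
      rintro _ ⟨x, hx, rfl⟩ _ ⟨y, hy, rfl⟩
      refine ⟨x + y, h x hx y hy, ?_⟩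
      simp only [smul_smul, smul_add]
      congr 2 <;> field_simp)
  rw [hone A α hα1 hA hα, hone B β hβ1 hB hβ, ENNReal.one_rpow, ENNReal.one_rpow, one_mul,
    Measure.addHaar_smul_of_nonneg _ (inv_nonneg.2 hs.le), finrank_euclideanSpace_fin,
    inv_pow, ENNReal.ofReal_inv_of_pos (by positivity)] at key
  have key2 : ENNReal.ofReal ((α + β) ^ n) ≤ volume C := by
    have h0 : ENNReal.ofReal ((α + β) ^ n) ≠ 0 := by
      rw [Ne, ENNReal.ofReal_eq_zero, not_le]
      positivity
    rw [mul_comm, ← div_eq_mul_inv, ENNReal.le_div_iff_mul_le (Or.inl h0) (Or.inl ENNReal.ofReal_ne_top)] at key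
    simpa using key
  rw [ENNReal.ofReal_le_iff_le_toReal hC.measure_lt_top.ne] at key2
  rw [← Real.pow_rpow_inv_natCast hs.le hn]
  exact Real.rpow_le_rpow (by positivity) key2 hninv.le

/-! ### Differentiating the volume of parallel bodies -/

theorem setOf_lt_max_one_sub_gauge {E : Type*} [NormedAddCommGroup E] [NormedSpace ℝ E]
    {C : Set E} (hC : Convex ℝ C) (h0 : C ∈ 𝓝 0) {t : ℝ} (ht : t ∈ Ioo (0 : ℝ) 1) :
    {x | t < max 0 (1 - gauge C x)} = (1 - t) • interior C := by
  have hs : 0 < 1 - t := sub_pos.2 ht.2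
  ext x
  rw [mem_smul_set_iff_inv_smul_mem₀ hs.ne', ← gauge_lt_one_iff_mem_interior hC h0,
    gauge_smul_of_nonneg (inv_nonneg.2 hs.le), smul_eq_mul, inv_mul_lt_one₀ hs, mem_ofPred_eq,
    lt_max_iff]
  constructor
  · rintro (h | h) <;> linarith [ht.1]
  · exact fun h => Or.inr (by linarith)

/-- The volume of a convex body is a constant multiple of the volume of the cone over it. -/
theorem exists_volume_eq_mul_integral_gauge (n : ℕ) :
    ∃ c : ℝ, ∀ C : Set (EuclideanSpace ℝ (Fin n)), Convex ℝ C → C ∈ 𝓝 0 →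
      (volume C).toReal = c * ∫ x, max 0 (1 - gauge C x) := by
  set c : ℝ≥0∞ := ∫⁻ t in Ioo (0 : ℝ) 1, ENNReal.ofReal ((1 - t) ^ n) with hc
  have hc0 : c ≠ 0 := by
    refine (setLIntegral_pos_iff (by fun_prop)).2 ?_ |>.ne'
    refine lt_of_lt_of_le ?_ (measure_mono (s := Ioo (0 : ℝ) 1) ?_)
    · simp
    · intro t ht
      refine ⟨?_, ht⟩
      have : 0 < 1 - t := sub_pos.2 ht.2
      simp only [Function.mem_support, ne_eq, ENNReal.ofReal_eq_zero, not_le]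
      positivity
  have hct : c ≠ ∞ := by
    refine ne_top_of_le_ne_top ENNReal.one_ne_top ?_
    calc c ≤ ∫⁻ t in Ioo (0 : ℝ) 1, 1 := by
          refine setLIntegral_mono' measurableSet_Ioo fun t ht => ?_
          rw [ENNReal.ofReal_le_one]
          exact pow_le_one₀ (sub_nonneg.2 ht.2.le) (by linarith [ht.1])
      _ = 1 := by simp
  refine ⟨c.toReal⁻¹, fun C hC h0 => ?_⟩
  have hcont : Continuous (gauge C) := continuous_gauge hC h0
  have key : ∫⁻ x, ENNReal.ofReal (max 0 (1 - gauge C x)) = c * volume C := by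
    rw [lintegral_eq_lintegral_meas_lt _ (f := fun x => max 0 (1 - gauge C x))
      (ae_of_all _ fun x => le_max_left _ _) (by fun_prop)]
    rw [← Ioo_union_Ici_eq_Ioi (zero_lt_one (α := ℝ)), lintegral_union measurableSet_Ici
      (by rw [Set.disjoint_left]; intro x hx hx'; exact absurd hx.2 (not_lt.2 hx'))]
    have h2 : ∫⁻ t in Ici (1 : ℝ), volume {x | t < max 0 (1 - gauge C x)} = 0 := by
      rw [setLIntegral_congr_fun (g := fun _ => 0) measurableSet_Ici]
      · simp
      · intro t ht
        have : {x | t < max 0 (1 - gauge C x)} = ∅ := by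
          ext x
          have := gauge_nonneg (s := C) x
          have := mem_Ici.1 ht
          simp only [mem_ofPred_eq, mem_empty_iff_false, iff_false, not_lt]
          exact max_le (by linarith) (by linarith)
        exact (congrArg volume this).trans measure_empty
    rw [h2, add_zero, hc, ← lintegral_mul_const _ (by fun_prop)]
    refine setLIntegral_congr_fun measurableSet_Ioo fun t ht => ?_
    rw [setOf_lt_max_one_sub_gauge hC h0 ht, Measure.addHaar_smul_of_nonneg _ (by linarith [ht.2]),
      finrank_euclideanSpace_fin,
      measure_congr (interior_ae_eq_of_null_frontier (hC.addHaar_frontier volume))]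
  rw [integral_eq_lintegral_of_nonneg_ae (f := fun x => max 0 (1 - gauge C x)) (ae_of_all _ fun x => le_max_left _ _)
    (by fun_prop), key, ENNReal.toReal_mul, inv_mul_cancel_left₀]
  exact (ENNReal.toReal_pos hc0 hct).ne'

section gaugeDerivative

variable {E : Type*} [NormedAddCommGroup E] [NormedSpace ℝ E] {s : Set E} {x : E}

theorem fderiv_gauge_le (hs : Convex ℝ s) (h0 : s ∈ 𝓝 0)
    (hd : DifferentiableAt ℝ (gauge s) x) (y : E) : fderiv ℝ (gauge s) x y ≤ gauge s y := by
  have h1 := hd.hasFDerivAt.hasLineDerivAt y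
  have h2 := h1.tendsto_slope_zero_right
  refine le_of_tendsto h2 ?_
  filter_upwards [self_mem_nhdsWithin] with t ht
  have ht : (0 : ℝ) < t := ht
  have h3 := gauge_add_le hs (absorbent_nhds_zero h0) x (t • y)
  rw [gauge_smul_of_nonneg ht.le, smul_eq_mul] at h3
  rw [smul_eq_mul, inv_mul_le_iff₀ ht]
  linarith

theorem fderiv_gauge_self (hd : DifferentiableAt ℝ (gauge s) x) :
    fderiv ℝ (gauge s) x x = gauge s x := by
  have h1 := hd.hasFDerivAt.hasLineDerivAt x
  have h2 := h1.tendsto_slope_zero_right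
  refine tendsto_nhds_unique h2 (tendsto_const_nhds.congr' ?_)
  filter_upwards [self_mem_nhdsWithin] with t ht
  have ht : (0 : ℝ) < t := ht
  have : x + t • x = (1 + t) • x := by rw [add_smul, one_smul]
  rw [this, gauge_smul_of_nonneg (by linarith), smul_eq_mul, smul_eq_mul]
  field_simp
  ring

end gaugeDerivative

section parallelBody

variable {n : ℕ} {Ω K : Set (EuclideanSpace ℝ (Fin n))}

theorem innerPar_zero (hK : K.Nonempty) : innerPar Ω K 0 = Ω := by
  obtain ⟨k, hk⟩ := hK
  ext x
  exact ⟨fun h => by simpa using h k hk, fun h y _ => by simpa using h⟩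

theorem isClosed_innerPar (hΩ : IsClosed Ω) (l : ℝ) : IsClosed (innerPar Ω K l) := by
  have : innerPar Ω K l = ⋂ y ∈ K, (fun x => x + l • y) ⁻¹' Ω := by
    ext x
    simp [innerPar]
  rw [this]
  exact isClosed_biInter fun y _ => hΩ.preimage (by fun_prop)

theorem isCompact_innerPar (hΩ : IsCompact Ω) (hK : K.Nonempty) (l : ℝ) :
    IsCompact (innerPar Ω K l) := by
  obtain ⟨k, hk⟩ := hK
  refine (hΩ.image (f := fun x => x - l • k) (by fun_prop)).of_isClosed_subset
    (isClosed_innerPar hΩ.isClosed l) fun x hx => ⟨x + l • k, hx k hk, by simp⟩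

theorem convex_innerPar (hΩ : Convex ℝ Ω) (l : ℝ) : Convex ℝ (innerPar Ω K l) := by
  intro x hx y hy a b ha hb hab k hk
  have h := hΩ (hx k hk) (hy k hk) ha hb hab
  have : a • x + b • y + l • k = a • (x + l • k) + b • (y + l • k) := by
    rw [smul_add, smul_add, add_add_add_comm, ← add_smul, hab, one_smul]
  rwa [this]

/-- The outer parallel body for `0 ≤ t`, and the inner parallel body at distance `-t` for `t < 0`. -/
def parallelBody (Ω K : Set (EuclideanSpace ℝ (Fin n))) (t : ℝ) :
    Set (EuclideanSpace ℝ (Fin n)) :=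
  if 0 ≤ t then Ω + t • K else innerPar Ω K (-t)

theorem parallelBody_of_nonneg {t : ℝ} (ht : 0 ≤ t) : parallelBody Ω K t = Ω + t • K := if_pos ht

theorem parallelBody_of_neg {t : ℝ} (ht : t < 0) : parallelBody Ω K t = innerPar Ω K (-t) :=
  if_neg ht.not_ge

theorem parallelBody_zero (hK : K.Nonempty) : parallelBody Ω K 0 = Ω := by
  rw [parallelBody_of_nonneg le_rfl, zero_smul_set hK, add_zero]

theorem convex_parallelBody (hΩ : Convex ℝ Ω) (hK : Convex ℝ K) (t : ℝ) :
    Convex ℝ (parallelBody Ω K t) := by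
  unfold parallelBody
  split_ifs
  · exact hΩ.add (hK.smul t)
  · exact convex_innerPar hΩ _

theorem exists_pos_smul_mem (h0 : Ω ∈ 𝓝 0) (hK : IsCompact K) :
    ∃ δ : ℝ, 0 < δ ∧ ∀ k ∈ K, δ • k ∈ Ω ∧ -(δ • k) ∈ Ω := by
  obtain ⟨ε, hε, hεΩ⟩ := Metric.mem_nhds_iff.1 h0
  obtain ⟨R, hR, hKR⟩ := hK.isBounded.exists_pos_norm_lt
  refine ⟨ε / R, by positivity, fun k hk => ?_⟩
  have : ‖(ε / R) • k‖ < ε := by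
    rw [norm_smul, Real.norm_of_nonneg (by positivity), div_mul_eq_mul_div, div_lt_iff₀ hR]
    exact mul_lt_mul_of_pos_left (hKR k hk) hε
  exact ⟨hεΩ (by simpa using this), hεΩ (by simpa using this)⟩

theorem smul_subset_parallelBody (hΩ : Convex ℝ Ω) (hK : K.Nonempty) {δ : ℝ} (hδ : 0 < δ)
    (h : ∀ k ∈ K, δ • k ∈ Ω ∧ -(δ • k) ∈ Ω) {t : ℝ} (ht : |t| ≤ δ) :
    (1 - |t| / δ) • Ω ⊆ parallelBody Ω K t := by
  have h1 : 0 ≤ 1 - |t| / δ := by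
    rw [sub_nonneg, div_le_one hδ]; exact ht
  have h2 : 0 ≤ |t| / δ := by positivity
  rintro _ ⟨ω, hω, rfl⟩
  rcases le_or_gt 0 t with h0 | h0
  · rw [parallelBody_of_nonneg h0]
    obtain ⟨k, hk⟩ := hK
    refine mem_add.2 ⟨(1 - |t| / δ) • ω + (|t| / δ) • -(δ • k),
      hΩ hω (h k hk).2 h1 h2 (by ring), t • k, smul_mem_smul_set hk, ?_⟩
    rw [smul_neg, smul_smul, div_mul_cancel₀ _ hδ.ne', abs_of_nonneg h0]
    simp
  · rw [parallelBody_of_neg h0]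
    intro k hk
    have := hΩ hω (h k hk).1 h1 h2 (by ring)
    rw [smul_smul, div_mul_cancel₀ _ hδ.ne'] at this
    simpa only [← abs_of_neg h0] using this

theorem parallelBody_subset_smul (hΩ : Convex ℝ Ω) (hK : K.Nonempty) {δ : ℝ} (hδ : 0 < δ)
    (h : ∀ k ∈ K, δ • k ∈ Ω ∧ -(δ • k) ∈ Ω) (t : ℝ) :
    parallelBody Ω K t ⊆ (1 + |t| / δ) • Ω := by
  have h2 : 0 ≤ |t| / δ := by positivity
  rw [hΩ.add_smul zero_le_one h2, one_smul]
  intro x hx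
  rcases le_or_gt 0 t with h0 | h0
  · rw [parallelBody_of_nonneg h0] at hx
    obtain ⟨ω, hω, _, ⟨k, hk, rfl⟩, rfl⟩ := mem_add.1 hx
    refine mem_add.2 ⟨ω, hω, _, smul_mem_smul_set (h k hk).1, ?_⟩
    rw [smul_smul, div_mul_cancel₀ _ hδ.ne', abs_of_nonneg h0]
  · rw [parallelBody_of_neg h0] at hx
    obtain ⟨k, hk⟩ := hK
    refine mem_add.2 ⟨_, hx k hk, _, smul_mem_smul_set (h k hk).2, ?_⟩
    rw [smul_neg, smul_smul, div_mul_cancel₀ _ hδ.ne', abs_of_neg h0]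
    simp

theorem gauge_le_mul_gauge_of_smul_subset {A B : Set (EuclideanSpace ℝ (Fin n))} {c : ℝ}
    (hc : 0 < c) (hA : A ∈ 𝓝 0) (h : c • A ⊆ B) (x : EuclideanSpace ℝ (Fin n)) :
    gauge B x ≤ c⁻¹ * gauge A x := by
  have := gauge_mono (absorbent_nhds_zero ((set_smul_mem_nhds_zero_iff hc.ne').2 hA)) h x
  rwa [gauge_smul_left_of_nonneg hc.le, Pi.smul_apply, smul_eq_mul] at this

/-- Convergence of the derivative of a function trapped above by `u` and below by `u + o(t)`. -/
theorem hasDerivAt_zero_of_eventually_le_add_mul {u v : ℝ → ℝ} {u' : ℝ} (hu : HasDerivAt u u' 0)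
    (h0 : v 0 = u 0) (hlow : ∀ᶠ t in 𝓝 0, u t ≤ v t)
    (hup : ∀ ε > 0, ∀ᶠ t in 𝓝 0, v t ≤ u t + ε * |t|) : HasDerivAt v u' 0 := by
  have : HasDerivAt (fun t => v t - u t) 0 0 := by
    rw [hasDerivAt_iff_isLittleO_nhds_zero, Asymptotics.isLittleO_iff]
    intro ε hε
    filter_upwards [hlow, hup ε hε] with t h1 h2
    rw [zero_add, h0, sub_self, sub_zero, smul_zero, sub_zero, Real.norm_eq_abs, Real.norm_eq_abs,
      abs_of_nonneg (sub_nonneg.2 h1)]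
    linarith
  have h := this.add hu
  rw [zero_add] at h
  exact h.congr_of_eventuallyEq (Eventually.of_forall fun t => by simp)

theorem le_gauge_parallelBody {t m : ℝ} {x : EuclideanSpace ℝ (Fin n)} (hP : parallelBody Ω K t ∈ 𝓝 0)
    (ℓ : EuclideanSpace ℝ (Fin n) →L[ℝ] ℝ) (hℓ : ∀ ω ∈ Ω, ℓ ω ≤ 1) {k : EuclideanSpace ℝ (Fin n)}
    (hk : k ∈ K) (hkm : ∀ y ∈ K, ℓ y ≤ ℓ k) (hm : m = ℓ k) (ht : 0 < 1 + t * m) :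
    ℓ x / (1 + t * m) ≤ gauge (parallelBody Ω K t) x := by
  by_contra! hlt
  obtain ⟨b, hb, hb', ⟨y, hy, rfl⟩⟩ := exists_lt_of_gauge_lt (absorbent_nhds_zero hP) hlt
  have hy1 : ℓ y ≤ 1 + t * m := by
    rcases le_or_gt 0 t with h0 | h0
    · rw [parallelBody_of_nonneg h0] at hy
      obtain ⟨ω, hω, _, ⟨z, hz, rfl⟩, rfl⟩ := mem_add.1 hy
      have h1 := hℓ ω hω
      have h2 := mul_le_mul_of_nonneg_left (hkm z hz) h0
      simp only [map_add, map_smul, smul_eq_mul]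
      rw [hm]
      linarith
    · rw [parallelBody_of_neg h0] at hy
      have := hℓ _ (hy k hk)
      simp only [map_add, map_smul, smul_eq_mul] at this
      rw [hm]
      linarith
  rw [lt_div_iff₀ ht] at hb'
  simp only [map_smul, smul_eq_mul] at hb'
  nlinarith

theorem gauge_parallelBody_le (hΩ : Convex ℝ Ω) (hΩc : IsClosed Ω) (h0 : Ω ∈ 𝓝 0) {s t m η R d : ℝ}
    {x : EuclideanSpace ℝ (Fin n)} (ℓ : EuclideanSpace ℝ (Fin n) →L[ℝ] ℝ)
    {k : EuclideanSpace ℝ (Fin n)} (hk : k ∈ K) (hkm : ∀ y ∈ K, ℓ y ≤ ℓ k) (hm : m = ℓ k)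
    (hR : ∀ y ∈ K, ‖y‖ ≤ R) (hη : 0 ≤ η)
    (hd : ∀ h, ‖h‖ < d → gauge Ω (x + h) ≤ gauge Ω x + ℓ h + η * ‖h‖)
    (hs : 0 < s) (hsd : s * |t| * R < d) (hst : gauge Ω x + η * (s * |t| * R) ≤ s * (1 + t * m)) :
    gauge (parallelBody Ω K t) x ≤ s := by
  have hmem : ∀ z, gauge Ω z ≤ s → s⁻¹ • z ∈ Ω := by
    intro z hz
    have : gauge Ω (s⁻¹ • z) ≤ 1 := by
      rw [gauge_smul_of_nonneg (inv_nonneg.2 hs.le), smul_eq_mul, inv_mul_le_one₀ hs]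
      exact hz
    rwa [gauge_le_one_iff_mem_closure hΩ h0, hΩc.closure_eq] at this
  have hnorm : ∀ y ∈ K, ‖(s * t) • y‖ ≤ s * |t| * R := by
    intro y hy
    rw [norm_smul, Real.norm_eq_abs, abs_mul, abs_of_pos hs]
    exact mul_le_mul_of_nonneg_left (hR y hy) (by positivity)
  have hsub : ∀ y ∈ K, t * m ≤ t * ℓ y → gauge Ω (x - (s * t) • y) ≤ s := by
    intro y hy hty
    have h1 := hd (-((s * t) • y)) (by rw [norm_neg]; exact (hnorm y hy).trans_lt hsd)
    have h2 := mul_le_mul_of_nonneg_left (hnorm y hy) hη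
    have h3 := mul_le_mul_of_nonneg_left hty hs.le
    rw [norm_neg, map_neg, map_smul, smul_eq_mul, ← sub_eq_add_neg] at h1
    linarith
  refine gauge_le_of_mem hs.le ((mem_smul_set_iff_inv_smul_mem₀ hs.ne' _ _).2 ?_)
  rcases le_or_gt 0 t with ht | ht
  · rw [parallelBody_of_nonneg ht]
    refine mem_add.2 ⟨_, hmem _ (hsub k hk (by rw [hm])), t • k, smul_mem_smul_set hk, ?_⟩
    rw [smul_sub, smul_smul, inv_mul_cancel_left₀ hs.ne', sub_add_cancel]
  · rw [parallelBody_of_neg ht]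
    intro y hy
    have h1 := hmem _ (hsub y hy (by rw [hm]; exact mul_le_mul_of_nonpos_left (hkm y hy) ht.le))
    rwa [smul_sub, smul_smul, inv_mul_cancel_left₀ hs.ne', sub_eq_add_neg, ← neg_smul] at h1

theorem parallelBody_mem_nhds (hΩ : Convex ℝ Ω) (h0 : Ω ∈ 𝓝 0) (hK : K.Nonempty) {δ : ℝ}
    (hδ : 0 < δ) (h : ∀ k ∈ K, δ • k ∈ Ω ∧ -(δ • k) ∈ Ω) {t : ℝ} (ht : |t| < δ) :
    parallelBody Ω K t ∈ 𝓝 0 := by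
  have h1 : 0 < 1 - |t| / δ := by
    rw [sub_pos, div_lt_one hδ]; exact ht
  exact mem_of_superset ((set_smul_mem_nhds_zero_iff h1.ne').2 h0)
    (smul_subset_parallelBody hΩ hK hδ h ht.le)

/-- The gauge of the parallel bodies of `Ω` is differentiable in the parameter wherever the gauge
of `Ω` is differentiable in space. -/
theorem exists_hasDerivAt_gauge_parallelBody (hΩ : Convex ℝ Ω) (hΩc : IsCompact Ω) (h0 : Ω ∈ 𝓝 0)
    (hKc : IsCompact K) (hK : K.Nonempty) {x : EuclideanSpace ℝ (Fin n)} (hx : x ≠ 0)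
    (hd : DifferentiableAt ℝ (gauge Ω) x) :
    ∃ D, HasDerivAt (fun t => gauge (parallelBody Ω K t) x) D 0 := by
  set ℓ := fderiv ℝ (gauge Ω) x with hℓ
  obtain ⟨k, hk, hkm⟩ := hKc.exists_isMaxOn hK ℓ.continuous.continuousOn
  obtain ⟨δ, hδ, hδK⟩ := exists_pos_smul_mem h0 hKc
  obtain ⟨R, hR, hKR⟩ := hKc.isBounded.exists_pos_norm_le
  set m := ℓ k with hm
  have hself : ℓ x = gauge Ω x := fderiv_gauge_self hd
  have hgx : 0 < gauge Ω x :=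
    (gauge_pos (absorbent_nhds_zero h0) ((NormedSpace.isVonNBounded_iff ℝ).2 hΩc.isBounded)).2 hx
  have hcont : ContinuousAt (fun t : ℝ => 1 + t * m) 0 := by fun_prop
  have hhalf : ∀ᶠ t : ℝ in 𝓝 0, 1 / 2 < 1 + t * m :=
    hcont.eventually_const_lt (by norm_num)
  have hsmall : ∀ᶠ t : ℝ in 𝓝 0, |t| < δ := by
    have : ContinuousAt (fun t : ℝ => |t|) 0 := by fun_prop
    exact this.eventually_lt_const (by simpa using hδ)
  have hu : HasDerivAt (fun t => gauge Ω x / (1 + t * m)) (-(gauge Ω x * m)) 0 := by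
    have h1 : HasDerivAt (fun t : ℝ => 1 + t * m) m 0 := by
      simpa using ((hasDerivAt_id (0 : ℝ)).mul_const m).const_add 1
    have h2 := (hasDerivAt_const (0 : ℝ) (gauge Ω x)).div h1 (by simp)
    simpa using! h2
  refine ⟨_, hasDerivAt_zero_of_eventually_le_add_mul hu (by simp [parallelBody_zero hK]) ?_ ?_⟩
  · filter_upwards [hhalf, hsmall] with t ht1 ht2
    rw [← hself]
    exact le_gauge_parallelBody (parallelBody_mem_nhds hΩ h0 hK hδ hδK ht2) ℓ
      (fun ω hω => (fderiv_gauge_le hΩ h0 hd ω).trans (gauge_le_one_of_mem hω)) hk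
      (fun y hy => hkm hy) hm (by linarith)
  · intro ε hε
    set S := 2 * gauge Ω x + ε with hS
    have hS0 : 0 < S := by positivity
    set η := ε / (2 * S * R) with hη
    have hη0 : 0 < η := by positivity
    have hlo := hd.hasFDerivAt.isLittleO
    rw [Asymptotics.isLittleO_iff] at hlo
    obtain ⟨d, hd0, hdd⟩ := Metric.eventually_nhds_iff.1 (hlo hη0)
    have hsd : ∀ᶠ t : ℝ in 𝓝 0, S * |t| * R < d := by
      have : ContinuousAt (fun t : ℝ => S * |t| * R) 0 := by fun_prop
      exact this.eventually_lt_const (by simpa using hd0)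
    have hone : ∀ᶠ t : ℝ in 𝓝 0, |t| < 1 := by
      have : ContinuousAt (fun t : ℝ => |t|) 0 := by fun_prop
      exact this.eventually_lt_const (by simp)
    filter_upwards [hhalf, hsd, hone] with t ht1 ht2 ht3
    have hp : 0 < 1 + t * m := by linarith
    have hs0 : 0 < gauge Ω x / (1 + t * m) + ε * |t| := by positivity
    have hsS : gauge Ω x / (1 + t * m) + ε * |t| ≤ S := by
      have h1 : gauge Ω x / (1 + t * m) ≤ 2 * gauge Ω x := by
        rw [div_le_iff₀ hp]
        nlinarith
      have h2 : ε * |t| ≤ ε := mul_le_of_le_one_right hε.le ht3.le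
      linarith
    have hsT : (gauge Ω x / (1 + t * m) + ε * |t|) * |t| * R ≤ S * |t| * R := by gcongr
    refine gauge_parallelBody_le hΩ hΩc.isClosed h0 ℓ (d := d) hk (fun y hy => hkm hy) hm hKR
      hη0.le ?_ hs0 (hsT.trans_lt ht2) ?_
    · intro h hh
      have := hdd (y := x + h) (by simpa using hh)
      rw [add_sub_cancel_left, Real.norm_eq_abs] at this
      linarith [le_abs_self (gauge Ω (x + h) - gauge Ω x - ℓ h)]
    · have h1 : (gauge Ω x / (1 + t * m) + ε * |t|) * (1 + t * m)
          = gauge Ω x + ε * |t| * (1 + t * m) := by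
        field_simp
      have h2 : η * (S * |t| * R) = ε * |t| * (1 / 2) := by
        rw [hη]; field_simp
      have h3 := mul_le_mul_of_nonneg_left hsT hη0.le
      have h4 : ε * |t| * (1 / 2) ≤ ε * |t| * (1 + t * m) := by gcongr
      linarith

end parallelBody

section volumeDerivative

variable {n : ℕ} {Ω K : Set (EuclideanSpace ℝ (Fin n))}

theorem gauge_parallelBody_bounds (hΩ : Convex ℝ Ω) (h0 : Ω ∈ 𝓝 0) (hK : K.Nonempty) {δ : ℝ}
    (hδ : 0 < δ) (h : ∀ k ∈ K, δ • k ∈ Ω ∧ -(δ • k) ∈ Ω) {t : ℝ} (ht : |t| < δ)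
    (x : EuclideanSpace ℝ (Fin n)) :
    (1 - |t| / δ) * gauge (parallelBody Ω K t) x ≤ gauge Ω x ∧
      gauge Ω x ≤ (1 + |t| / δ) * gauge (parallelBody Ω K t) x := by
  have h1 : 0 < 1 - |t| / δ := by
    rw [sub_pos, div_lt_one hδ]; exact ht
  have h2 : 0 < 1 + |t| / δ := by positivity
  have hP := parallelBody_mem_nhds hΩ h0 hK hδ h ht
  constructor
  · rw [← le_inv_mul_iff₀ h1]
    exact gauge_le_mul_gauge_of_smul_subset h1 h0 (smul_subset_parallelBody hΩ hK hδ h ht.le) x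
  · have hsub : (1 + |t| / δ)⁻¹ • parallelBody Ω K t ⊆ Ω := by
      rw [smul_set_subset_iff₀ (inv_ne_zero h2.ne'), inv_inv]
      exact parallelBody_subset_smul hΩ hK hδ h t
    simpa using gauge_le_mul_gauge_of_smul_subset (inv_pos.2 h2) hP hsub x

theorem abs_max_one_sub_gauge_parallelBody_sub_le (hΩ : Convex ℝ Ω) (h0 : Ω ∈ 𝓝 0)
    (hK : K.Nonempty) {δ : ℝ} (hδ : 0 < δ) (h : ∀ k ∈ K, δ • k ∈ Ω ∧ -(δ • k) ∈ Ω) {t : ℝ}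
    (ht : |t| < δ / 2) (x : EuclideanSpace ℝ (Fin n)) :
    |max 0 (1 - gauge (parallelBody Ω K t) x) - max 0 (1 - gauge Ω x)| ≤
      ({x | gauge Ω x ≤ 2}.indicator (fun _ => 4 / δ) x) * |t| := by
  obtain ⟨h1, h2⟩ := gauge_parallelBody_bounds hΩ h0 hK hδ h (ht.trans (half_lt_self hδ)) x
  set g := gauge Ω x with hg
  set p := gauge (parallelBody Ω K t) x with hp
  have hp0 : 0 ≤ p := gauge_nonneg x
  have ht0 : 0 ≤ |t| / δ := by positivity
  have ht1 : |t| / δ < 1 / 2 := by rw [div_lt_iff₀ hδ]; linarith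
  by_cases hx : x ∈ {x | gauge Ω x ≤ 2}
  · rw [indicator_of_mem hx]
    have hg2 : g ≤ 2 := hx
    have hp4 : p ≤ 4 := by nlinarith
    have h3 : |p - g| ≤ 4 / δ * |t| := by
      have : 4 / δ * |t| = 4 * (|t| / δ) := by ring
      rw [this, abs_le]
      constructor <;> nlinarith
    refine le_trans ?_ h3
    refine (abs_max_sub_max_le_max _ _ _ _).trans ?_
    simp [abs_sub_comm]
  · rw [indicator_of_notMem hx, zero_mul]
    have hg2 : 2 < g := not_le.1 hx
    have hp1 : 1 ≤ p := by nlinarith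
    rw [max_eq_left (by linarith), max_eq_left (by linarith)]
    simp

theorem ae_gauge_ne_one (hΩ : Convex ℝ Ω) (h0 : Ω ∈ 𝓝 0) : ∀ᵐ x, gauge Ω x ≠ 1 := by
  rw [ae_iff]
  refine measure_mono_null (fun x hx => ?_) (hΩ.addHaar_frontier volume)
  exact (gauge_eq_one_iff_mem_frontier hΩ h0).1 (not_not.1 hx)

theorem hasDerivAt_max_zero_one_sub {u : ℝ → ℝ} {D : ℝ} (hu : HasDerivAt u D 0) (h1 : u 0 ≠ 1) :
    ∃ D', HasDerivAt (fun t => max 0 (1 - u t)) D' 0 := by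
  rcases lt_or_gt_of_ne h1 with h | h
  · refine ⟨_, (hu.const_sub 1).congr_of_eventuallyEq ?_⟩
    filter_upwards [hu.continuousAt.eventually_lt_const h] with t ht
    exact max_eq_right (by linarith)
  · refine ⟨_, (hasDerivAt_const (0 : ℝ) (0 : ℝ)).congr_of_eventuallyEq ?_⟩
    filter_upwards [hu.continuousAt.eventually_const_lt h] with t ht
    exact max_eq_left (by linarith)

theorem ae_exists_hasDerivAt_max_gauge (hn : n ≠ 0) (hΩ : Convex ℝ Ω) (hΩc : IsCompact Ω)
    (h0 : Ω ∈ 𝓝 0) (hKc : IsCompact K) (hK : K.Nonempty) :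
    ∀ᵐ x, ∃ D, HasDerivAt (fun t => max 0 (1 - gauge (parallelBody Ω K t) x)) D 0 := by
  have : Nonempty (Fin n) := ⟨⟨0, Nat.pos_of_ne_zero hn⟩⟩
  obtain ⟨L, hL⟩ := hΩ.lipschitz_gauge h0
  have hx0 : ∀ᵐ x : EuclideanSpace ℝ (Fin n), x ≠ 0 := by
    simp [ae_iff]
  filter_upwards [hL.ae_differentiableAt, ae_gauge_ne_one hΩ h0, hx0] with x hx1 hx2 hx3
  obtain ⟨D, hD⟩ := exists_hasDerivAt_gauge_parallelBody hΩ hΩc h0 hKc hK hx3 hx1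
  exact hasDerivAt_max_zero_one_sub hD (by rwa [parallelBody_zero hK])

/-- The volume of the parallel bodies is differentiable at zero, from both sides. -/
theorem exists_hasDerivAt_volume_parallelBody_of_mem_nhds (hn : n ≠ 0) (hΩ : Convex ℝ Ω)
    (hΩc : IsCompact Ω) (h0 : Ω ∈ 𝓝 0) (hK : Convex ℝ K) (hKc : IsCompact K) (hKne : K.Nonempty) :
    ∃ D, HasDerivAt (fun t => (volume (parallelBody Ω K t)).toReal) D 0 := by
  obtain ⟨c, hc⟩ := exists_volume_eq_mul_integral_gauge n
  obtain ⟨δ, hδ, hδK⟩ := exists_pos_smul_mem h0 hKc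
  set F : ℝ → EuclideanSpace ℝ (Fin n) → ℝ :=
    fun t x => max 0 (1 - gauge (parallelBody Ω K t) x) with hF
  have hsmall : ∀ᶠ t : ℝ in 𝓝 0, |t| < δ / 2 := by
    have : ContinuousAt (fun t : ℝ => |t|) 0 := by fun_prop
    exact this.eventually_lt_const (by simpa using hδ)
  have hcompact : IsCompact {x | gauge Ω x ≤ 2} := by
    refine (hΩc.smul (2 : ℝ)).of_isClosed_subset
      (isClosed_le (continuous_gauge hΩ h0) continuous_const) fun x hx => ?_
    rw [mem_smul_set_iff_inv_smul_mem₀ two_ne_zero, ← hΩc.isClosed.closure_eq,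
      ← gauge_le_one_iff_mem_closure hΩ h0, gauge_smul_of_nonneg (by norm_num), smul_eq_mul,
      inv_mul_le_one₀ two_pos]
    exact hx
  have hcont : ∀ t, |t| < δ / 2 → Continuous (F t) := by
    intro t ht
    have := continuous_gauge (convex_parallelBody hΩ hK t)
      (parallelBody_mem_nhds hΩ h0 hKne hδ hδK (ht.trans (half_lt_self hδ)))
    exact continuous_const.max (continuous_const.sub this)
  have hbound : ∀ t, |t| < δ / 2 → ∀ x,
      |F t x - F 0 x| ≤ ({x | gauge Ω x ≤ 2}.indicator (fun _ => 4 / δ) x) * |t| := by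
    intro t ht x
    simpa only [hF, parallelBody_zero hKne] using
      abs_max_one_sub_gauge_parallelBody_sub_le hΩ h0 hKne hδ hδK ht x
  have hbint : Integrable ({x | gauge Ω x ≤ 2}.indicator fun _ => 4 / δ) := by
    rw [integrable_indicator_iff hcompact.measurableSet]
    exact integrableOn_const hcompact.measure_lt_top.ne
  have hF0 : Integrable (F 0) := by
    refine Integrable.mono' (g := {x | gauge Ω x ≤ 2}.indicator fun _ => 1) ?_
      (hcont 0 (by simpa using hδ)).aestronglyMeasurable (ae_of_all _ fun x => ?_)
    · rw [integrable_indicator_iff hcompact.measurableSet]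
      exact integrableOn_const hcompact.measure_lt_top.ne
    · have hg := gauge_nonneg (s := Ω) x
      simp only [hF, parallelBody_zero hKne, Real.norm_eq_abs, abs_of_nonneg (le_max_left (0 : ℝ) _)]
      by_cases hx : x ∈ {x | gauge Ω x ≤ 2}
      · rw [indicator_of_mem hx]
        exact max_le zero_le_one (by linarith)
      · rw [indicator_of_notMem hx]
        have : 2 < gauge Ω x := not_le.1 hx
        exact max_le le_rfl (by linarith)
  have hint : ∀ t, |t| < δ / 2 → Integrable (F t) := by
    intro t ht
    have : Integrable (fun x => F t x - F 0 x) :=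
      (hbint.mul_const |t|).mono'
        ((hcont t ht).sub (hcont 0 (by simpa using hδ))).aestronglyMeasurable
        (ae_of_all _ fun x => hbound t ht x)
    exact (this.add hF0).congr (ae_of_all _ fun x => by simp)
  have hder := ae_exists_hasDerivAt_max_gauge hn hΩ hΩc h0 hKc hKne
  have key : HasDerivAt (fun t => ∫ x, F t x) (∫ x, deriv (fun t => F t x) 0) 0 := by
    rw [hasDerivAt_iff_tendsto_slope]
    have hev : ∀ᶠ t in 𝓝[≠] (0 : ℝ), ∫ x, slope (fun s => F s x) 0 t
        = slope (fun s => ∫ x, F s x) 0 t := by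
      filter_upwards [nhdsWithin_le_nhds hsmall] with t ht
      simp only [slope_def_module]
      rw [integral_smul, integral_sub (hint t ht) hF0]
    refine Tendsto.congr' hev ?_
    refine tendsto_integral_filter_of_dominated_convergence
      ({x | gauge Ω x ≤ 2}.indicator fun _ => 4 / δ) ?_ ?_ hbint ?_
    · filter_upwards [nhdsWithin_le_nhds hsmall] with t ht
      simp only [slope_def_module]
      exact (((hint t ht).sub hF0).smul (t - 0)⁻¹).aestronglyMeasurable
    · filter_upwards [nhdsWithin_le_nhds hsmall, self_mem_nhdsWithin] with t ht ht0
      refine ae_of_all _ fun x => ?_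
      have : 0 < |t| := abs_pos.2 ht0
      rw [slope_def_module, sub_zero, norm_smul, norm_inv, Real.norm_eq_abs, Real.norm_eq_abs,
        inv_mul_le_iff₀ this, mul_comm]
      exact hbound t ht x
    · filter_upwards [hder] with x hx
      obtain ⟨D, hD⟩ := hx
      rw [hD.deriv]
      exact hasDerivAt_iff_tendsto_slope.1 hD
  refine ⟨_, (key.const_mul c).congr_of_eventuallyEq ?_⟩
  filter_upwards [hsmall] with t ht
  exact hc _ (convex_parallelBody hΩ hK t)
    (parallelBody_mem_nhds hΩ h0 hKne hδ hδK (ht.trans (half_lt_self hδ)))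

theorem parallelBody_vadd (v : EuclideanSpace ℝ (Fin n)) (t : ℝ) :
    parallelBody (v +ᵥ Ω) K t = v +ᵥ parallelBody Ω K t := by
  unfold parallelBody
  split_ifs
  · rw [vadd_add_assoc]
  · ext x
    simp only [innerPar, mem_ofPred_eq, mem_vadd_set_iff_neg_vadd_mem, vadd_eq_add, add_assoc]

/-- The volumes of the outer and of the inner parallel bodies of a convex body have opposite
one-sided derivatives at zero. -/
theorem exists_hasDerivWithinAt_volume_parallel (hn : n ≠ 0) (hΩ : Convex ℝ Ω)
    (hΩc : IsCompact Ω) (hΩint : (interior Ω).Nonempty) (hK : Convex ℝ K) (hKc : IsCompact K)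
    (hKne : K.Nonempty) :
    ∃ D, HasDerivWithinAt (fun t : ℝ => (volume (Ω + t • K)).toReal) D (Ici 0) 0 ∧
      HasDerivWithinAt (fun t : ℝ => (volume (innerPar Ω K t)).toReal) (-D) (Ici 0) 0 := by
  obtain ⟨v, hv⟩ := hΩint
  have h0 : -v +ᵥ Ω ∈ 𝓝 0 := by
    have : (fun x => v + x) ⁻¹' Ω ∈ 𝓝 0 :=
      (by fun_prop : ContinuousAt (fun x => v + x) 0).preimage_mem_nhds
        (by simpa using mem_interior_iff_mem_nhds.1 hv)
    refine mem_of_superset this fun x hx => ?_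
    simpa [mem_vadd_set_iff_neg_vadd_mem] using hx
  obtain ⟨D, hD⟩ := exists_hasDerivAt_volume_parallelBody_of_mem_nhds hn (hΩ.vadd (-v))
    (hΩc.vadd (-v)) h0 hK hKc hKne
  simp only [parallelBody_vadd, measure_vadd] at hD
  refine ⟨D, ?_, ?_⟩
  · refine hD.hasDerivWithinAt.congr (fun t ht => ?_) ?_
    · rw [parallelBody_of_nonneg ht]
    · rw [parallelBody_of_nonneg le_rfl]
  · have h1 : HasDerivAt (fun t => (volume (parallelBody Ω K (-t))).toReal) (-D) 0 := by
      have hD' : HasDerivAt (fun t => (volume (parallelBody Ω K t)).toReal) D (-0) := by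
        rwa [neg_zero]
      simpa using! hD'.comp (0 : ℝ) (hasDerivAt_neg (0 : ℝ))
    have h2 : ∀ t ∈ Ici (0 : ℝ), (volume (innerPar Ω K t)).toReal
        = (volume (parallelBody Ω K (-t))).toReal := by
      intro t ht
      rcases (mem_Ici.1 ht).eq_or_lt with rfl | ht
      · rw [neg_zero, parallelBody_zero hKne, innerPar_zero hKne]
      · rw [parallelBody_of_neg (neg_neg_of_pos ht), neg_neg]
    exact h1.hasDerivWithinAt.congr h2 (h2 0 self_mem_Ici)

end volumeDerivative

section rigidity

/-- A concave function on `[0, r]` that vanishes at `r` and meets the chord at an interior point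
is equal to the chord. -/
theorem ConcaveOn.eq_chord_of_touch {w : ℝ → ℝ} {r l₀ : ℝ} (hw : ConcaveOn ℝ (Icc 0 r) w)
    (hwr : w r = 0) (hl₀ : l₀ ∈ Ioo 0 r) (h : w l₀ = (1 - l₀ / r) * w 0) {l : ℝ}
    (hl : l ∈ Icc 0 r) : w l = (1 - l / r) * w 0 := by
  obtain ⟨h0, h1⟩ := hl₀
  have hr : 0 < r := h0.trans h1
  have m0 : (0 : ℝ) ∈ Icc 0 r := left_mem_Icc.2 hr.le
  have mr : r ∈ Icc 0 r := right_mem_Icc.2 hr.le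
  refine le_antisymm ?_ ?_
  · rcases lt_trichotomy l l₀ with hlt | rfl | hlt
    · have hrl : 0 < r - l := by linarith
      have := hw.2 hl mr
        (show 0 ≤ (r - l₀) / (r - l) from div_nonneg (by linarith) hrl.le)
        (show 0 ≤ (l₀ - l) / (r - l) from div_nonneg (by linarith) hrl.le) (by field_simp; ring)
      have e : ((r - l₀) / (r - l)) • l + ((l₀ - l) / (r - l)) • r = l₀ := by
        simp only [smul_eq_mul]; field_simp; ring
      rw [e, hwr, h, smul_zero, add_zero, smul_eq_mul, div_mul_eq_mul_div, div_le_iff₀ hrl] at this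
      have e2 : (1 - l₀ / r) * w 0 * (r - l) = (r - l₀) * ((1 - l / r) * w 0) := by
        field_simp
      rw [e2] at this
      exact le_of_mul_le_mul_left this (by linarith)
    · exact h.le
    · have hl0 : 0 < l := h0.trans hlt
      have := hw.2 m0 hl (show 0 ≤ (l - l₀) / l from div_nonneg (by linarith) hl0.le)
        (show 0 ≤ l₀ / l from div_nonneg h0.le hl0.le) (by field_simp; ring)
      have e : ((l - l₀) / l) • (0 : ℝ) + (l₀ / l) • l = l₀ := by
        simp only [smul_eq_mul]; field_simp; ring
      rw [e, h, smul_eq_mul, smul_eq_mul, div_mul_eq_mul_div, div_mul_eq_mul_div, ← add_div,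
        div_le_iff₀ hl0] at this
      have e2 : (1 - l₀ / r) * w 0 * l = (l - l₀) * w 0 + l₀ * ((1 - l / r) * w 0) := by
        field_simp; ring
      rw [e2] at this
      exact le_of_mul_le_mul_left (le_of_add_le_add_left this) h0
  · have := hw.2 m0 mr (show 0 ≤ 1 - l / r by rw [sub_nonneg, div_le_one hr]; exact hl.2)
      (div_nonneg hl.1 hr.le) (by ring)
    simpa [hwr, div_mul_cancel₀ l hr.ne'] using this

/-- If `w` is concave, with right derivative `-a` at `0` and at `l₀`, then the equality case of
`w (l₀) ^ m * a (l₀) ≥ ((1 - l₀ / r) * w 0) ^ m * a 0` forces `w` to meet its chord at `l₀`. -/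
theorem ConcaveOn.touch_of_pow_mul_eq {w : ℝ → ℝ} {r l₀ κ a₀ a₁ : ℝ} {m : ℕ} (hm : m ≠ 0)
    (hw : ConcaveOn ℝ (Icc 0 r) w) (hw0 : 0 ≤ w 0) (hwr : w r = 0) (hl₀ : l₀ ∈ Ioo 0 r)
    (hκ : 0 < κ)
    (hdec : ∀ l ∈ Icc 0 r, w l + l * κ ≤ w 0) (h₀ : HasDerivWithinAt w (-a₀) (Ioi 0) 0)
    (h₁ : HasDerivWithinAt w (-a₁) (Ioi l₀) l₀)
    (heq : w l₀ ^ m * a₁ = ((1 - l₀ / r) * w 0) ^ m * a₀) : w l₀ = (1 - l₀ / r) * w 0 := by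
  obtain ⟨hl0, hlr⟩ := hl₀
  have hr : 0 < r := hl0.trans hlr
  have m0 : (0 : ℝ) ∈ Icc 0 r := left_mem_Icc.2 hr.le
  have mr : r ∈ Icc 0 r := right_mem_Icc.2 hr.le
  have ml : l₀ ∈ Icc 0 r := ⟨hl0.le, hlr.le⟩
  have ha₀ : κ ≤ a₀ := by
    rw [← neg_le_neg_iff]
    refine le_of_tendsto ((hasDerivWithinAt_iff_tendsto_slope' self_notMem_Ioi).1 h₀) ?_
    filter_upwards [Ioo_mem_nhdsGT hr] with t ht
    have := hdec t ⟨ht.1.le, ht.2.le⟩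
    rw [slope_def_field, sub_zero, div_le_iff₀ ht.1]
    linarith
  have ha : a₀ ≤ a₁ := by
    rw [← neg_le_neg_iff]
    refine le_trans ?_ (hw.slope_le_of_hasDerivWithinAt_Ioi m0 ml hl0 h₀)
    refine le_of_tendsto ((hasDerivWithinAt_iff_tendsto_slope' self_notMem_Ioi).1 h₁) ?_
    filter_upwards [Ioo_mem_nhdsGT hlr] with t ht
    have := hw.slope_anti_adjacent m0 ⟨hl0.le.trans ht.1.le, ht.2.le⟩ hl0 ht.1
    simpa only [slope_def_field] using this
  have hc : 0 ≤ 1 - l₀ / r := by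
    rw [sub_nonneg, div_le_one hr]; exact hlr.le
  have hchord : (1 - l₀ / r) * w 0 ≤ w l₀ := by
    have := hw.2 m0 mr hc (div_nonneg hl0.le hr.le) (by ring)
    simpa [hwr, div_mul_cancel₀ l₀ hr.ne'] using this
  refine (hchord.eq_or_lt.resolve_right fun hlt => ?_).symm
  have h1 := pow_lt_pow_left₀ hlt (mul_nonneg hc hw0) hm
  have h2 : 0 ≤ ((1 - l₀ / r) * w 0) ^ m := pow_nonneg (mul_nonneg hc hw0) m
  have : ((1 - l₀ / r) * w 0) ^ m * a₀ < w l₀ ^ m * a₁ :=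
    (mul_lt_mul_of_pos_right h1 (hκ.trans_le ha₀)).trans_le
      (mul_le_mul_of_nonneg_left ha (h2.trans h1.le))
  exact this.ne' heq

/-- Rigidity for a function `v` with concave `n`-th root: if the right derivative `-p` satisfies
`p l₀ = (1 - l₀ / r) ^ (n - 1) * p 0` at one interior point, then `v` is the `n`-th power of an
affine function, and the identity holds at every point. -/
theorem rigidity_of_concaveOn_rpow {n : ℕ} (hn : 2 ≤ n) {v p : ℝ → ℝ} {r l₀ κ : ℝ}
    (hv : ∀ l ∈ Ico 0 r, 0 < v l) (hvr : v r = 0)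
    (hconc : ConcaveOn ℝ (Icc 0 r) fun l => v l ^ (n : ℝ)⁻¹) (hκ : 0 < κ)
    (hdec : ∀ l ∈ Icc 0 r, v l ^ (n : ℝ)⁻¹ + l * κ ≤ v 0 ^ (n : ℝ)⁻¹)
    (hder : ∀ l ∈ Ico 0 r, HasDerivWithinAt v (-p l) (Ici l) l) (hl₀ : l₀ ∈ Ioo 0 r)
    (heq : p l₀ = (1 - l₀ / r) ^ (n - 1) * p 0) :
    (∀ l ∈ Icc 0 r, v l = (1 - l / r) ^ n * v 0) ∧
      ∀ l ∈ Ico 0 r, p l = (1 - l / r) ^ (n - 1) * p 0 := by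
  have hr : 0 < r := hl₀.1.trans hl₀.2
  have hn0 : n ≠ 0 := by omega
  have hnR : (n : ℝ) ≠ 0 := Nat.cast_ne_zero.2 hn0
  have hninv : (n : ℝ)⁻¹ ≠ 0 := inv_ne_zero hnR
  set w : ℝ → ℝ := fun l => v l ^ (n : ℝ)⁻¹ with hw
  have hv0 : ∀ l ∈ Icc 0 r, 0 ≤ v l := by
    intro l hl
    rcases hl.2.eq_or_lt with rfl | h
    · exact hvr.ge
    · exact (hv l ⟨hl.1, h⟩).le
  have hwv : ∀ l ∈ Icc 0 r, w l ^ n = v l := fun l hl => Real.rpow_inv_natCast_pow (hv0 l hl) hn0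
  have m0 : (0 : ℝ) ∈ Ico 0 r := left_mem_Ico.2 hr
  have hder' : ∀ l ∈ Ico 0 r,
      HasDerivWithinAt w (-(p l * (n : ℝ)⁻¹ * v l ^ ((n : ℝ)⁻¹ - 1))) (Ioi l) l := by
    intro l hl
    have := ((hder l hl).mono Ioi_subset_Ici_self).rpow_const (p := (n : ℝ)⁻¹)
      (Or.inl (hv l hl).ne')
    convert this using 1
    ring
  have hpow : ∀ l ∈ Ico 0 r,
      w l ^ (n - 1) * (p l * (n : ℝ)⁻¹ * v l ^ ((n : ℝ)⁻¹ - 1)) = p l * (n : ℝ)⁻¹ := by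
    intro l hl
    have hvl := hv l hl
    have h1 : w l ^ (n - 1) * v l ^ ((n : ℝ)⁻¹ - 1) = 1 := by
      rw [hw, ← Real.rpow_natCast, ← Real.rpow_mul hvl.le, ← Real.rpow_add hvl,
        Nat.cast_sub (by omega), Nat.cast_one]
      have : (n : ℝ)⁻¹ * ((n : ℝ) - 1) + ((n : ℝ)⁻¹ - 1) = 0 := by field_simp; ring
      rw [this, Real.rpow_zero]
    calc _ = p l * (n : ℝ)⁻¹ * (w l ^ (n - 1) * v l ^ ((n : ℝ)⁻¹ - 1)) := by ring
      _ = _ := by rw [h1, mul_one]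
  have hwr : w r = 0 := by simp only [hw, hvr, Real.zero_rpow hninv]
  have htouch := hconc.touch_of_pow_mul_eq (m := n - 1) (by omega)
    (Real.rpow_nonneg (hv 0 m0).le _) hwr hl₀ hκ hdec (hder' 0 m0) (hder' l₀ ⟨hl₀.1.le, hl₀.2⟩) (by
      rw [mul_pow, mul_assoc (_ ^ (n - 1)), hpow 0 m0, hpow l₀ ⟨hl₀.1.le, hl₀.2⟩, heq, mul_assoc])
  have hvol : ∀ l ∈ Icc 0 r, v l = (1 - l / r) ^ n * v 0 := by
    intro l hl
    rw [← hwv l hl, ← hwv 0 (left_mem_Icc.2 hr.le), ← mul_pow]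
    exact congrArg (· ^ n) (hconc.eq_chord_of_touch hwr hl₀ htouch hl)
  have hp : ∀ l ∈ Ico 0 r, p l = (1 - l / r) ^ (n - 1) * (n / r * v 0) := by
    intro l hl
    have hd : HasDerivAt (fun l => (1 - l / r) ^ n * v 0)
        (-((1 - l / r) ^ (n - 1) * (n / r * v 0))) l := by
      refine ((((hasDerivAt_id' l).div_const r).const_sub 1).fun_pow n |>.mul_const
        (v 0)).congr_deriv ?_
      ring
    have hd' : HasDerivWithinAt v (-((1 - l / r) ^ (n - 1) * (n / r * v 0))) (Ici l) l := by
      refine hd.hasDerivWithinAt.congr_of_eventuallyEq ?_ (hvol l ⟨hl.1, hl.2.le⟩)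
      filter_upwards [Icc_mem_nhdsGE hl.2] with t ht
      exact hvol t ⟨hl.1.trans ht.1, ht.2⟩
    exact neg_injective ((uniqueDiffWithinAt_Ici l).eq_deriv _ (hder l hl) hd')
  refine ⟨hvol, fun l hl => ?_⟩
  rw [hp l hl, hp 0 m0]
  simp

end rigidity

section innerParallelFamily

variable {n : ℕ} {Ω K : Set (EuclideanSpace ℝ (Fin n))}

theorem innerPar_innerPar (hK : Convex ℝ K) {l t : ℝ} (hl : 0 ≤ l) (ht : 0 ≤ t) :
    innerPar (innerPar Ω K l) K t = innerPar Ω K (l + t) := by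
  ext x
  constructor
  · intro h y hy
    have := h y hy y hy
    rwa [add_assoc, ← add_smul, add_comm t l] at this
  · intro h y hy z hz
    have hmem : l • z + t • y ∈ (l + t) • K := by
      rw [hK.add_smul hl ht]
      exact add_mem_add (smul_mem_smul_set hz) (smul_mem_smul_set hy)
    obtain ⟨k, hk, hke⟩ := hmem
    have := h k hk
    simp only at hke
    rwa [hke, add_comm (l • z), ← add_assoc] at this

theorem innerPar_add_smul_subset (hK : Convex ℝ K) {l t : ℝ} (ht : 0 ≤ t) (htl : t ≤ l) :
    innerPar Ω K l + t • K ⊆ innerPar Ω K (l - t) := by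
  rintro _ ⟨x, hx, _, ⟨y, hy, rfl⟩, rfl⟩
  rw [← sub_add_cancel l t, ← innerPar_innerPar hK (sub_nonneg.2 htl) ht] at hx
  exact hx y hy

theorem smul_add_smul_mem_innerPar (hΩ : Convex ℝ Ω) {a b s u : ℝ} (hs : 0 ≤ s) (hu : 0 ≤ u)
    (hsu : s + u = 1) {x y : EuclideanSpace ℝ (Fin n)} (hx : x ∈ innerPar Ω K a)
    (hy : y ∈ innerPar Ω K b) : s • x + u • y ∈ innerPar Ω K (s * a + u * b) := by
  intro k hk
  have := hΩ (hx k hk) (hy k hk) hs hu hsu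
  have e : s • x + u • y + (s * a + u * b) • k = s • (x + a • k) + u • (y + b • k) := by
    module
  rwa [e]

theorem inrad_mem (hn : n ≠ 0) (hΩc : IsCompact Ω) (hΩ : Ω.Nonempty)
    (hKint : (interior K).Nonempty) :
    BddAbove {l : ℝ | 0 ≤ l ∧ ∃ x, ∀ y ∈ K, x + l • y ∈ Ω} ∧
      inrad Ω K ∈ {l : ℝ | 0 ≤ l ∧ ∃ x, ∀ y ∈ K, x + l • y ∈ Ω} := by
  have : Nonempty (Fin n) := ⟨⟨0, Nat.pos_of_ne_zero hn⟩⟩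
  obtain ⟨c, hc⟩ := hKint
  obtain ⟨d, hd, hdc⟩ : ∃ d ∈ K, d ≠ c := by
    have h : ∀ᶠ x in 𝓝[≠] c, x ∈ K ∧ x ≠ c :=
      (eventually_nhdsWithin_of_eventually_nhds (mem_interior_iff_mem_nhds.1 hc)).and
        self_mem_nhdsWithin
    exact h.exists
  have hcK := interior_subset hc
  obtain ⟨M, hM⟩ : BddAbove {l : ℝ | 0 ≤ l ∧ ∃ x, ∀ y ∈ K, x + l • y ∈ Ω} := by
    refine ⟨Metric.diam Ω / dist d c, ?_⟩
    rintro l ⟨hl, x, hx⟩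
    rw [le_div_iff₀ (dist_pos.2 hdc)]
    have := Metric.dist_le_diam_of_mem hΩc.isBounded (hx d hd) (hx c hcK)
    rwa [dist_add_left, dist_smul₀, Real.norm_eq_abs, abs_of_nonneg hl] at this
  refine ⟨⟨M, hM⟩, ?_⟩
  have hcpt : IsCompact ((fun p : ℝ × EuclideanSpace ℝ (Fin n) => (p.1, p.2 - p.1 • c)) ''
      (Icc 0 M ×ˢ Ω)) := (isCompact_Icc.prod hΩc).image (by fun_prop)
  have hcl : IsClosed {p : ℝ × EuclideanSpace ℝ (Fin n) | ∀ y ∈ K, p.2 + p.1 • y ∈ Ω} := by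
    have : {p : ℝ × EuclideanSpace ℝ (Fin n) | ∀ y ∈ K, p.2 + p.1 • y ∈ Ω}
        = ⋂ y ∈ K, (fun p : ℝ × EuclideanSpace ℝ (Fin n) => p.2 + p.1 • y) ⁻¹' Ω := by
      ext p; simp
    rw [this]
    exact isClosed_biInter fun y _ => hΩc.isClosed.preimage (by fun_prop)
  have himage : {l : ℝ | 0 ≤ l ∧ ∃ x, ∀ y ∈ K, x + l • y ∈ Ω} = Prod.fst ''
      ((fun p : ℝ × EuclideanSpace ℝ (Fin n) => (p.1, p.2 - p.1 • c)) '' (Icc 0 M ×ˢ Ω) ∩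
        {p : ℝ × EuclideanSpace ℝ (Fin n) | ∀ y ∈ K, p.2 + p.1 • y ∈ Ω}) := by
    ext l
    constructor
    · rintro ⟨hl, x, hx⟩
      exact ⟨(l, x), ⟨⟨(l, x + l • c), ⟨⟨hl, hM ⟨hl, x, hx⟩⟩, hx c hcK⟩, by simp⟩, hx⟩, rfl⟩
    · rintro ⟨⟨l', x⟩, ⟨⟨⟨m, z⟩, hmz, he⟩, hx⟩, rfl⟩
      simp only [Prod.mk.injEq] at he
      exact ⟨he.1 ▸ hmz.1.1, x, hx⟩
  have hS : IsCompact {l : ℝ | 0 ≤ l ∧ ∃ x, ∀ y ∈ K, x + l • y ∈ Ω} := by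
    rw [himage]
    exact (hcpt.inter_right hcl).image continuous_fst
  refine hS.sSup_mem ?_
  obtain ⟨ω, hω⟩ := hΩ
  exact ⟨0, le_rfl, ω, fun y _ => by simpa using hω⟩

/-- The extremal inner parallel body has empty interior, hence zero volume. -/
theorem volume_innerPar_inrad (hn : n ≠ 0) (hΩc : IsCompact Ω) (hΩ : Convex ℝ Ω)
    (hΩne : Ω.Nonempty) (hKc : IsCompact K) (hK : Convex ℝ K) (hKint : (interior K).Nonempty) :
    volume (innerPar Ω K (inrad Ω K)) = 0 := by
  obtain ⟨hbdd, hr, -⟩ := inrad_mem hn hΩc hΩne hKint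
  have hint : interior (innerPar Ω K (inrad Ω K)) = ∅ := by
    rw [← not_nonempty_iff_eq_empty]
    rintro ⟨x, hx⟩
    have hnhds : (fun y => x + y) ⁻¹' innerPar Ω K (inrad Ω K) ∈ 𝓝 0 :=
      (by fun_prop : ContinuousAt (fun y => x + y) 0).preimage_mem_nhds
        (by simpa using mem_interior_iff_mem_nhds.1 hx)
    obtain ⟨δ, hδ, h⟩ := exists_pos_smul_mem hnhds hKc
    have hmem : x ∈ innerPar Ω K (inrad Ω K + δ) := by
      rw [← innerPar_innerPar hK hr hδ.le]
      exact fun y hy => (h y hy).1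
    have : inrad Ω K + δ ≤ inrad Ω K := le_csSup hbdd ⟨by positivity, x, hmem⟩
    linarith
  refine measure_mono_null ?_ ((convex_innerPar hΩ (K := K) (inrad Ω K)).addHaar_frontier volume)
  rw [(isClosed_innerPar hΩc.isClosed _).frontier_eq, hint, sdiff_empty]

theorem interior_innerPar_nonempty (hΩ : Convex ℝ Ω) (hΩint : (interior Ω).Nonempty)
    (hK : K.Nonempty) {r : ℝ} (hr : (innerPar Ω K r).Nonempty) {l : ℝ} (hl : l ∈ Ico 0 r) :
    (interior (innerPar Ω K l)).Nonempty := by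
  obtain ⟨z, hz⟩ := hr
  have hr0 : 0 < r := hl.1.trans_lt hl.2
  have hs : 0 < 1 - l / r := by
    rw [sub_pos, div_lt_one hr0]; exact hl.2
  have hsub : (l / r) • z +ᵥ (1 - l / r) • Ω ⊆ innerPar Ω K l := by
    rintro _ ⟨_, ⟨x, hx, rfl⟩, rfl⟩
    rw [← innerPar_zero (Ω := Ω) hK] at hx
    have := smul_add_smul_mem_innerPar hΩ hs.le (div_nonneg hl.1 hr0.le) (by ring) hx hz
    rw [mul_zero, zero_add, div_mul_cancel₀ l hr0.ne', add_comm] at this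
    exact this
  refine Nonempty.mono (interior_mono hsub) ?_
  rw [interior_vadd, interior_smul₀ hs.ne']
  exact (hΩint.smul_set).vadd_set

theorem toReal_volume_smul_rpow {A : Set (EuclideanSpace ℝ (Fin n))} (hn : n ≠ 0) {s : ℝ}
    (hs : 0 ≤ s) :
    (volume (s • A)).toReal ^ (n : ℝ)⁻¹ = s * (volume A).toReal ^ (n : ℝ)⁻¹ := by
  rw [Measure.addHaar_smul_of_nonneg _ hs, finrank_euclideanSpace_fin, ENNReal.toReal_mul,
    ENNReal.toReal_ofReal (by positivity), Real.mul_rpow (by positivity) ENNReal.toReal_nonneg,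
    Real.pow_rpow_inv_natCast hs hn]

theorem concaveOn_volume_innerPar (hn : n ≠ 0) (hΩc : IsCompact Ω) (hΩ : Convex ℝ Ω)
    (hK : K.Nonempty) {S : Set ℝ} (hS : Convex ℝ S) (hne : ∀ l ∈ S, (innerPar Ω K l).Nonempty) :
    ConcaveOn ℝ S fun l => (volume (innerPar Ω K l)).toReal ^ (n : ℝ)⁻¹ := by
  refine ⟨hS, fun a ha b hb s u hs hu hsu => ?_⟩
  simp only [smul_eq_mul]
  rw [← toReal_volume_smul_rpow hn hs, ← toReal_volume_smul_rpow hn hu]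
  refine ((isCompact_innerPar hΩc hK a).smul s).brunn_minkowski hn
    ((isCompact_innerPar hΩc hK b).smul u) (isCompact_innerPar hΩc hK _) (hne a ha).smul_set
    (hne b hb).smul_set ?_
  rintro _ ⟨x, hx, rfl⟩ _ ⟨y, hy, rfl⟩
  exact smul_add_smul_mem_innerPar hΩ hs hu hsu hx hy

theorem hasDerivWithinAt_volume_innerPar (hn : n ≠ 0) (hΩc : IsCompact Ω) (hΩ : Convex ℝ Ω)
    (hKc : IsCompact K) (hK : Convex ℝ K) (hKne : K.Nonempty) {l : ℝ} (hl : 0 ≤ l)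
    (hint : (interior (innerPar Ω K l)).Nonempty) :
    HasDerivWithinAt (fun l => (volume (innerPar Ω K l)).toReal) (-aniPer (innerPar Ω K l) K)
      (Ici l) l := by
  obtain ⟨D, hD, hD'⟩ := exists_hasDerivWithinAt_volume_parallel hn (convex_innerPar hΩ l)
    (isCompact_innerPar hΩc hKne l) hint hK hKc hKne
  have hper : aniPer (innerPar Ω K l) K = D := hD.derivWithin (uniqueDiffWithinAt_Ici 0)
  rw [hper]
  have hsub : HasDerivWithinAt (fun s => s - l) 1 (Ici l) l :=
    (hasDerivWithinAt_id l _).sub_const l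
  have hcomp := HasDerivWithinAt.comp l (h := fun s => s - l) (s' := Ici 0)
    (by rwa [sub_self]) hsub fun s hs => sub_nonneg.2 hs
  rw [mul_one] at hcomp
  have hEq : ∀ s ∈ Ici l, (volume (innerPar Ω K s)).toReal
      = (volume (innerPar (innerPar Ω K l) K (s - l))).toReal := by
    intro s hs
    rw [innerPar_innerPar hK hl (sub_nonneg.2 hs), add_sub_cancel]
  exact hcomp.congr hEq (hEq l self_mem_Ici)

/-- The anisotropic perimeter of a body whose parallel bodies have volume `O(t ^ 2)` vanishes. -/
theorem aniPer_eq_zero_of_le {C : Set (EuclideanSpace ℝ (Fin n))} {r M : ℝ} (hr : 0 < r)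
    (hn : 2 ≤ n)
    (h : ∀ t ∈ Icc 0 r, (volume (C + t • K)).toReal ≤ M * t ^ n) : aniPer C K = 0 := by
  have h0 : (volume (C + (0 : ℝ) • K)).toReal = 0 := by
    refine le_antisymm ?_ ENNReal.toReal_nonneg
    have := h 0 (left_mem_Icc.2 hr.le)
    rwa [zero_pow (by omega), mul_zero] at this
  refine HasDerivWithinAt.derivWithin ?_ (uniqueDiffWithinAt_Ici 0)
  have hd : HasDerivAt (fun t : ℝ => M * t ^ n) 0 0 := by
    have := (hasDerivAt_pow n (0 : ℝ)).const_mul M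
    rwa [zero_pow (by omega), mul_zero, mul_zero] at this
  have hO : (fun t : ℝ => (volume (C + t • K)).toReal) =O[𝓝[≥] 0] fun t => M * t ^ n := by
    refine Asymptotics.IsBigO.of_bound 1 ?_
    filter_upwards [Icc_mem_nhdsGE hr] with t ht
    rw [one_mul, Real.norm_eq_abs, abs_of_nonneg ENNReal.toReal_nonneg]
    exact (h t ht).trans (le_abs_self _)
  rw [hasDerivWithinAt_iff_isLittleO]
  have hd' := hasDerivWithinAt_iff_isLittleO.1 (hd.hasDerivWithinAt (s := Ici 0))
  simp only [h0, smul_zero, sub_zero, zero_pow (show n ≠ 0 by omega), mul_zero] at hd' ⊢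
  exact hO.trans_isLittleO hd'

end innerParallelFamily

/-- if equality holds in the Larson inequality for some
`λ₀ ∈ (0, r)`, then equality holds for every `λ ∈ [0, r]`. -/
theorem stmt16 {n : ℕ} (hn : 2 ≤ n) (Ω K : Set (EuclideanSpace ℝ (Fin n)))
    (hΩc : IsCompact Ω) (hΩconv : Convex ℝ Ω) (hΩint : (interior Ω).Nonempty)
    (hKc : IsCompact K) (hKconv : Convex ℝ K) (hKint : (interior K).Nonempty)
    (l0 : ℝ) (hl0 : l0 ∈ Set.Ioo 0 (inrad Ω K))
    (heq : aniPer (innerPar Ω K l0) K = (1 - l0 / inrad Ω K) ^ (n - 1) * aniPer Ω K) :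
    ∀ l ∈ Set.Icc 0 (inrad Ω K),
      aniPer (innerPar Ω K l) K = (1 - l / inrad Ω K) ^ (n - 1) * aniPer Ω K := by
  have hn0 : n ≠ 0 := by omega
  have hKne : K.Nonempty := hKint.mono interior_subset
  have hΩne : Ω.Nonempty := hΩint.mono interior_subset
  obtain ⟨-, -, hrne⟩ := inrad_mem hn0 hΩc hΩne hKint
  have hr : 0 < inrad Ω K := hl0.1.trans hl0.2
  have hint : ∀ l ∈ Ico 0 (inrad Ω K), (interior (innerPar Ω K l)).Nonempty := fun l hl =>
    interior_innerPar_nonempty hΩconv hΩint hKne hrne hl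
  have hne : ∀ l ∈ Icc 0 (inrad Ω K), (innerPar Ω K l).Nonempty := by
    intro l hl
    rcases hl.2.eq_or_lt with rfl | h
    · exact hrne
    · exact (hint l ⟨hl.1, h⟩).mono interior_subset
  have hfin : ∀ l, volume (innerPar Ω K l) ≠ ⊤ := fun l =>
    (isCompact_innerPar hΩc hKne l).measure_lt_top.ne
  have hr0 := volume_innerPar_inrad hn0 hΩc hΩconv hΩne hKc hKconv hKint
  have hKpos : 0 < (volume K).toReal := ENNReal.toReal_pos
    (Measure.measure_pos_of_nonempty_interior volume hKint).ne' hKc.measure_lt_top.ne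
  have hdec : ∀ l ∈ Icc 0 (inrad Ω K),
      (volume (innerPar Ω K l)).toReal ^ (n : ℝ)⁻¹ + l * (volume K).toReal ^ (n : ℝ)⁻¹
        ≤ (volume (innerPar Ω K 0)).toReal ^ (n : ℝ)⁻¹ := by
    intro l hl
    rw [← toReal_volume_smul_rpow hn0 hl.1]
    refine (isCompact_innerPar hΩc hKne l).brunn_minkowski hn0 (hKc.smul l)
      (isCompact_innerPar hΩc hKne 0) (hne l hl) hKne.smul_set fun x hx y hy => ?_
    have := innerPar_add_smul_subset hKconv hl.1 le_rfl (add_mem_add hx hy)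
    rwa [sub_self] at this
  obtain ⟨hvol, hper⟩ := rigidity_of_concaveOn_rpow hn
    (v := fun l => (volume (innerPar Ω K l)).toReal) (p := fun l => aniPer (innerPar Ω K l) K)
    (fun l hl => ENNReal.toReal_pos
      (Measure.measure_pos_of_nonempty_interior volume (hint l hl)).ne' (hfin l))
    (by simp [hr0]) (concaveOn_volume_innerPar hn0 hΩc hΩconv hKne (convex_Icc _ _) hne)
    (Real.rpow_pos_of_pos hKpos _) hdec
    (fun l hl => hasDerivWithinAt_volume_innerPar hn0 hΩc hΩconv hKc hKconv hKne hl.1 (hint l hl))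
    hl0 (by rwa [innerPar_zero hKne])
  simp only [innerPar_zero hKne] at hvol hper
  intro l hl
  rcases hl.2.eq_or_lt with rfl | h
  · rw [div_self hr.ne', sub_self, zero_pow (by omega), zero_mul]
    refine aniPer_eq_zero_of_le hr hn (M := (volume Ω).toReal / inrad Ω K ^ n) fun t ht => ?_
    refine (ENNReal.toReal_mono (hfin _)
      (measure_mono (innerPar_add_smul_subset hKconv ht.1 ht.2))).trans ?_
    rw [hvol _ ⟨sub_nonneg.2 ht.2, sub_le_self _ ht.1⟩, sub_div, div_self hr.ne', sub_sub_cancel,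
      div_pow]
    exact (by ring : _ = _).le
  · exact hper l ⟨hl.1, h⟩
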